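/- arXiv:2212.03072 — 6 statements merged into one kernel-verified Lean document; each statement's English description precedes it below -/
import Mathlib

section
/- For all real numbers x > 0 and y > 0, exp(x) > (1 + x/y)^y and (1 + x/y)^y > exp(xy/(x + y)). -/
open Real

theorem exp_gt_rpow_gt_exp (x y : ℝ) (hx : 0 < x) (hy : 0 < y) :
    Real.exp x > (1 + x / y) ^ y ∧ (1 + x / y) ^ y > Real.exp (x * y / (x + y)) := by
  have hxy : 0 < x / y := div_pos hx hy
  have ht : 0 < x / (x + y) := by positivity
  constructor
  · calc (1 + x / y) ^ y < Real.exp (x / y) ^ y := by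
          refine Real.rpow_lt_rpow (by positivity) ?_ hy
          linarith [Real.add_one_lt_exp hxy.ne']
      _ = Real.exp x := by rw [← Real.exp_mul, div_mul_cancel₀ x hy.ne']
  · have hlt : Real.exp (x / (x + y)) < 1 + x / y := by
      have h := Real.add_one_lt_exp (neg_ne_zero.mpr ht.ne')
      have heq : -(x / (x + y)) + 1 = (1 + x / y)⁻¹ := by
        field_simp
        ring
      rw [heq, Real.exp_neg] at h
      exact (inv_lt_inv₀ (by positivity) (Real.exp_pos _)).mp h
    calc Real.exp (x * y / (x + y)) = Real.exp (x / (x + y)) ^ y := by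
          rw [← Real.exp_mul, div_mul_eq_mul_div]
      _ < (1 + x / y) ^ y := Real.rpow_lt_rpow (Real.exp_pos _).le hlt hy
end

section
/- For all integers k ≥ 2 and b with 1 ≤ b ≤ k/2, it holds that g(z*) < 0, where z* = 5·2^b. -/
/-- For integers `k ≥ 2`, `1 ≤ b ≤ k/2`, with `d = 5·2^(k-b)` and `z* = 5·2^b`,
the one-step recursion function
`g(z) = (2^b - 1)·(1 + 1/(2^(k-2b)·z + 2^(k-2b) - 1))^d - z` satisfies `g(z*) < 0`. -/
theorem g_at_zstar_neg (k b : ℕ) (hk : 2 ≤ k) (hb : 1 ≤ b) (hbk : 2 * b ≤ k) :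
    ((2 : ℝ) ^ b - 1) *
        (1 + 1 / ((2 : ℝ) ^ (k - 2 * b) * (5 * 2 ^ b) + (2 : ℝ) ^ (k - 2 * b) - 1))
          ^ (5 * 2 ^ (k - b)) - 5 * 2 ^ b < 0 := by
  obtain ⟨m, rfl⟩ := Nat.exists_eq_add_of_le hbk
  rw [show 2 * b + m - 2 * b = m by omega, show 2 * b + m - b = m + b by omega]
  have hB : (1 : ℝ) ≤ 2 ^ b := one_le_pow₀ one_le_two
  have hM : (1 : ℝ) ≤ 2 ^ m := one_le_pow₀ one_le_two
  set n : ℝ := 2 ^ m * (5 * 2 ^ b) + 2 ^ m - 1 with hn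
  have hd : (0 : ℝ) < 2 ^ m * (5 * 2 ^ b) := by positivity
  have hn_pos : 0 < n := by linarith
  have hpow : (1 + 1 / n) ^ (5 * 2 ^ (m + b)) ≤ Real.exp 1 := calc
    (1 + 1 / n) ^ (5 * 2 ^ (m + b)) ≤ Real.exp (1 / n) ^ (5 * 2 ^ (m + b)) := by
      gcongr
      linarith [Real.add_one_le_exp (1 / n)]
    _ = Real.exp (2 ^ m * (5 * 2 ^ b) / n) := by
      rw [← Real.exp_nat_mul]
      push_cast
      ring_nf
    _ ≤ Real.exp 1 := by
      gcongr
      rw [div_le_one hn_pos]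
      linarith
  have he : Real.exp 1 ≤ 5 := by linarith [Real.exp_one_lt_d9]
  have hmul := mul_le_mul_of_nonneg_left (hpow.trans he) (sub_nonneg.2 hB)
  linarith
end

section
/- For all integers k ≥ 2 and b with 1 ≤ b ≤ k/2, it holds that f(z*) > 0, where z* = 5·2^b. -/
theorem one_add_one_div_pow_le_exp_div {a : ℝ} (ha : 0 < a) (n : ℕ) :
    (1 + 1 / a) ^ n ≤ Real.exp (n / a) := by
  calc (1 + 1 / a) ^ n ≤ Real.exp (1 / a) ^ n := by
        gcongr
        linarith [Real.add_one_le_exp (1 / a)]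
    _ = Real.exp (n / a) := by rw [← Real.exp_nat_mul]; ring_nf

theorem exp_div_add_one_le_one_add_one_div_pow {a : ℝ} (ha : 0 < a) (n : ℕ) :
    Real.exp (n / (a + 1)) ≤ (1 + 1 / a) ^ n := by
  have h : Real.exp (1 / (a + 1)) ≤ 1 + 1 / a := by
    rw [← Real.le_log_iff_exp_le (by positivity)]
    refine le_trans (le_of_eq ?_) (Real.one_sub_inv_le_log_of_pos (by positivity))
    field_simp
    ring
  calc Real.exp (n / (a + 1)) = Real.exp (1 / (a + 1)) ^ n := by
        rw [← Real.exp_nat_mul]; ring_nf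
    _ ≤ (1 + 1 / a) ^ n := by gcongr

theorem five_mul_one_add_lt_exp {t : ℝ} (ht : 0 ≤ t) (ht1 : t ≤ 1) :
    5 * (1 + t) < Real.exp (5 * (1 + t) / (Real.exp 1 + t)) := by
  have he := Real.exp_one_lt_d9
  have he' := Real.exp_one_gt_d9
  have hu : 1 + 0.8 + 0.8 * t ≤ 5 * (1 + t) / (Real.exp 1 + t) := by
    rw [le_div_iff₀ (by positivity)]
    nlinarith
  refine lt_of_lt_of_le ?_ (Real.exp_le_exp.2 hu)
  rw [Real.exp_add, Real.exp_add]
  have h1 := Real.quadratic_le_exp_of_nonneg (x := 0.8) (by norm_num)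
  have h2 := Real.add_one_le_exp (0.8 * t)
  calc 5 * (1 + t) < 2.718 * 2.12 * (0.8 * t + 1) := by linarith
    _ ≤ Real.exp 1 * Real.exp 0.8 * Real.exp (0.8 * t) := by
        gcongr <;> linarith

theorem five_mul_lt_two_step_recursion {B C : ℝ} (hB : 2 ≤ B) (hC : 1 ≤ C) {d : ℕ}
    (hd : (d : ℝ) = 5 * (B * C)) :
    5 * B < (B - 1) * (1 + 1 / (C * (B - 1) *
      (1 + 1 / (C * (5 * B) + C - 1)) ^ d + C - 1)) ^ d := by
  have hN : 0 < C * (5 * B) + C - 1 := by nlinarith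
  have hx : (1 + 1 / (C * (5 * B) + C - 1)) ^ d ≤ Real.exp 1 := by
    refine (one_add_one_div_pow_le_exp_div hN d).trans (Real.exp_le_exp.2 ?_)
    rw [div_le_one hN, hd]
    linarith
  have hx0 : 0 < (1 + 1 / (C * (5 * B) + C - 1)) ^ d := by positivity
  set x := (1 + 1 / (C * (5 * B) + C - 1)) ^ d
  have hB1 : 0 < B - 1 := by linarith
  have hm : 0 < C * (B - 1) * x + C - 1 := by
    have : 0 < C * (B - 1) * x := by positivity
    linarith
  have ht := five_mul_one_add_lt_exp (t := 1 / (B - 1)) (by positivity)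
    (by rw [div_le_one hB1]; linarith)
  have hexp : 5 * (1 + 1 / (B - 1)) / (Real.exp 1 + 1 / (B - 1)) ≤
      d / (C * (B - 1) * x + C - 1 + 1) := by
    have hl : 5 * (1 + 1 / (B - 1)) / (Real.exp 1 + 1 / (B - 1)) =
        d / (C * (B - 1) * Real.exp 1 + C) := by
      have : 0 < Real.exp 1 := Real.exp_pos 1
      rw [hd, div_eq_div_iff (by positivity) (by positivity)]
      field_simp
      ring
    rw [hl, sub_add_cancel]
    gcongr
  calc 5 * B = (B - 1) * (5 * (1 + 1 / (B - 1))) := by field_simp; ring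
    _ < (B - 1) * Real.exp (5 * (1 + 1 / (B - 1)) / (Real.exp 1 + 1 / (B - 1))) := by gcongr
    _ ≤ (B - 1) * Real.exp (d / (C * (B - 1) * x + C - 1 + 1)) := by gcongr
    _ ≤ _ := by
        gcongr
        exact exp_div_add_one_le_one_add_one_div_pow hm d

/-- For integers `k ≥ 2`, `1 ≤ b ≤ k/2`, with `d = 5·2^(k-b)` and `z* = 5·2^b`,
the two-step recursion function
`f(z) = (2^b-1)·(1 + 1/(2^(k-2b)·(2^b-1)·(1 + 1/(2^(k-2b)·z + 2^(k-2b) - 1))^d + 2^(k-2b) - 1))^d - z`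
satisfies `f(z*) > 0`. -/
theorem f_at_zstar_pos (k b : ℕ) (hk : 2 ≤ k) (hb : 1 ≤ b) (hbk : 2 * b ≤ k) :
    ((2 : ℝ) ^ b - 1) *
        (1 + 1 / ((2 : ℝ) ^ (k - 2 * b) * ((2 : ℝ) ^ b - 1) *
            (1 + 1 / ((2 : ℝ) ^ (k - 2 * b) * (5 * 2 ^ b) + (2 : ℝ) ^ (k - 2 * b) - 1))
              ^ (5 * 2 ^ (k - b)) + (2 : ℝ) ^ (k - 2 * b) - 1))
          ^ (5 * 2 ^ (k - b)) - 5 * 2 ^ b > 0 := by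
  refine sub_pos.2 (five_mul_lt_two_step_recursion ?_ (one_le_pow₀ one_le_two) ?_)
  · exact le_self_pow₀ one_le_two (by omega)
  · rw [← pow_add, show b + (k - 2 * b) = k - b by omega]
    push_cast
    rfl
end

section
/- For all integers k ≥ 3 and b with 1 ≤ b ≤ k/2, it holds that f(z*) > (2^b − 1)·exp(5·2^{b+k} / (2^k + 2^{2b} + 2^k·(2^b − 1)·e)) − 5·2^b, where z* = 5·2^b and e is Euler's number. -/
theorem one_add_one_div_pow_le_exp_one {t : ℝ} {d : ℕ} (ht : 0 < t) (hdt : (d : ℝ) ≤ t) :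
    (1 + 1 / t) ^ d ≤ Real.exp 1 := by
  have h1 : 1 + 1 / t ≤ Real.exp (1 / t) := by
    linarith [Real.add_one_le_exp (1 / t)]
  calc (1 + 1 / t) ^ d ≤ Real.exp (1 / t) ^ d := by gcongr
    _ = Real.exp (d * (1 / t)) := (Real.exp_nat_mul _ _).symm
    _ ≤ Real.exp 1 := by
      gcongr
      rw [mul_one_div]
      exact (div_le_one ht).2 hdt

theorem exp_one_div_add_one_le {t : ℝ} (ht : 0 < t) :
    Real.exp (1 / (t + 1)) ≤ 1 + 1 / t := by
  have h := Real.add_one_le_exp (-(1 / (t + 1)))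
  rw [Real.exp_neg] at h
  have h2 : -(1 / (t + 1)) + 1 = (1 + 1 / t)⁻¹ := by
    field_simp
    ring
  rw [h2] at h
  exact (inv_le_inv₀ (by positivity) (Real.exp_pos _)).1 h

/-- If `t + 1 < s` then `(1 + 1 / t) ^ d` strictly dominates `exp (d / s)`. -/
theorem exp_div_lt_one_add_one_div_pow {t s : ℝ} {d : ℕ} (ht : 0 < t) (hts : t + 1 < s)
    (hd : d ≠ 0) : Real.exp (d / s) < (1 + 1 / t) ^ d := by
  have h1 : Real.exp (1 / s) < 1 + 1 / t :=
    lt_of_lt_of_le (Real.exp_lt_exp.2 (one_div_lt_one_div_of_lt (by linarith) hts))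
      (exp_one_div_add_one_le ht)
  calc Real.exp (d / s) = Real.exp (1 / s) ^ d := by
        rw [← Real.exp_nat_mul, mul_one_div]
    _ < (1 + 1 / t) ^ d := pow_lt_pow_left₀ h1 (Real.exp_pos _).le hd


/-- For integers `k ≥ 3`, `1 ≤ b ≤ k/2`, with `d = 5·2^(k-b)` and `z* = 5·2^b`,
`f(z*) > (2^b - 1)·exp(5·2^(b+k) / (2^k + 2^(2b) + 2^k·(2^b - 1)·e)) - 5·2^b`. -/
theorem f_at_zstar_lower_bound (k b : ℕ) (hk : 3 ≤ k) (hb : 1 ≤ b) (hbk : 2 * b ≤ k) :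
    ((2 : ℝ) ^ b - 1) *
        (1 + 1 / ((2 : ℝ) ^ (k - 2 * b) * ((2 : ℝ) ^ b - 1) *
            (1 + 1 / ((2 : ℝ) ^ (k - 2 * b) * (5 * 2 ^ b) + (2 : ℝ) ^ (k - 2 * b) - 1))
              ^ (5 * 2 ^ (k - b)) + (2 : ℝ) ^ (k - 2 * b) - 1))
          ^ (5 * 2 ^ (k - b)) - 5 * 2 ^ b >
      ((2 : ℝ) ^ b - 1) *
          Real.exp (5 * 2 ^ (b + k) /
            ((2 : ℝ) ^ k + (2 : ℝ) ^ (2 * b) + (2 : ℝ) ^ k * ((2 : ℝ) ^ b - 1) * Real.exp 1))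
        - 5 * 2 ^ b := by
  obtain ⟨m, rfl⟩ := Nat.exists_eq_add_of_le hbk
  have e1 : 2 * b + m - 2 * b = m := by omega
  have e2 : 2 * b + m - b = b + m := by omega
  rw [e1, e2]
  have hx : (2 : ℝ) ≤ 2 ^ b := by
    simpa using pow_le_pow_right₀ (one_le_two : (1 : ℝ) ≤ 2) hb
  have hM : (1 : ℝ) ≤ 2 ^ m := one_le_pow₀ one_le_two
  have hd : ((5 * 2 ^ (b + m) : ℕ) : ℝ) = 5 * 2 ^ b * 2 ^ m := by
    push_cast
    ring
  have hd0 : 5 * 2 ^ (b + m) ≠ 0 := by positivity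
  have e3 : (5 * 2 ^ (b + (2 * b + m)) : ℝ) /
        (2 ^ (2 * b + m) + 2 ^ (2 * b) + 2 ^ (2 * b + m) * (2 ^ b - 1) * Real.exp 1) =
      ((5 * 2 ^ (b + m) : ℕ) : ℝ) / (2 ^ m + 1 + 2 ^ m * (2 ^ b - 1) * Real.exp 1) := by
    rw [hd, show (5 * 2 ^ (b + (2 * b + m)) : ℝ) = 2 ^ (2 * b) * (5 * 2 ^ b * 2 ^ m) by ring,
      show (2 ^ (2 * b + m) + 2 ^ (2 * b) + 2 ^ (2 * b + m) * (2 ^ b - 1) * Real.exp 1 : ℝ) =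
        2 ^ (2 * b) * (2 ^ m + 1 + 2 ^ m * (2 ^ b - 1) * Real.exp 1) by ring]
    exact mul_div_mul_left _ _ (by positivity)
  rw [e3]
  generalize 5 * 2 ^ (b + m) = d at *
  generalize (2 : ℝ) ^ b = x at *
  generalize (2 : ℝ) ^ m = M at *
  have hMx : 0 < M * (x - 1) := mul_pos (by linarith) (by linarith)
  have ht : 0 < M * (5 * x) + M - 1 := by nlinarith
  have hA := one_add_one_div_pow_le_exp_one (d := d) ht (by linarith)
  have hA0 : 0 < (1 + 1 / (M * (5 * x) + M - 1)) ^ d := by positivity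
  have hT := mul_pos hMx hA0
  have hTe := mul_le_mul_of_nonneg_left hA hMx.le
  exact sub_lt_sub_right (mul_lt_mul_of_pos_left
    (exp_div_lt_one_add_one_div_pow (by linarith) (by linarith) hd0) (by linarith)) _
end

section
/- For all integers k ≥ 2 and b with 1 ≤ b ≤ k/2, setting λ = 2^b − 1, γ = 1 − 2^{−(k−2b)} and d = 5·2^{k−b}, there exist real numbers x > 0 and y > 0 with x ≠ y such that x = λ·((y + 1)/(y + γ))^d and y = λ·((x + 1)/(x + γ))^d. -/
open Set Filter Topology

/-- A strictly decreasing continuous self-map of `[a, ∞)` whose derivative at a fixed point is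
below `-1` has a genuine cycle of length two. -/
theorem exists_two_cycle_of_deriv_lt_neg_one {f : ℝ → ℝ} {a p c : ℝ}
    (hcont : ContinuousOn f (Ici a)) (hmaps : ∀ x, a ≤ x → a < f x)
    (hanti : StrictAntiOn f (Ici a)) (hap : a < p) (hp : f p = p)
    (hderiv : HasDerivAt f c p) (hc : c < -1) :
    ∃ x, a < x ∧ x < p ∧ p < f x ∧ f (f x) = x := by
  have hff : HasDerivAt (f ∘ f) (c * c) p := by
    refine HasDerivAt.comp p ?_ hderiv
    rwa [hp]
  have hslope : ∀ᶠ x in 𝓝[<] p, 1 < slope (f ∘ f) p x :=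
    ((hasDerivAt_iff_tendsto_slope.1 hff).mono_left
      (nhdsWithin_mono _ fun x (hx : x < p) => hx.ne)).eventually_const_lt (by nlinarith)
  obtain ⟨q, hq, haq, hqp⟩ := (hslope.and (Ioo_mem_nhdsLT hap)).exists
  have hq' : f (f q) < q := by
    rw [slope_def_field, lt_div_iff_of_neg (sub_neg.2 hqp)] at hq
    simp only [Function.comp_apply, hp] at hq
    linarith
  have hcomp : ContinuousOn (fun x => f (f x) - x) (Icc a q) :=
    ((hcont.comp hcont fun x hx => (hmaps x hx).le).mono Icc_subset_Ici_self).sub continuousOn_id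
  obtain ⟨x, hx, hx0⟩ := intermediate_value_Icc' haq.le hcomp
    (show (0 : ℝ) ∈ Icc _ _ from
      ⟨(sub_neg.2 hq').le, (sub_pos.2 (hmaps _ (hmaps a le_rfl).le)).le⟩)
  have hfx : f (f x) = x := sub_eq_zero.1 hx0
  have hxp : x < p := hx.2.trans_lt hqp
  refine ⟨x, ?_, hxp, ?_, hfx⟩
  · exact hfx ▸ hmaps _ (hmaps x hx.1).le
  · simpa only [hp] using hanti hx.1 hap.le hxp

/-- The tree recursion of the 2-spin system with `β = 1` on the `d`-ary tree. -/
noncomputable def treeRecursion (lam γ : ℝ) (d : ℕ) (y : ℝ) : ℝ :=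
  lam * ((y + 1) / (y + γ)) ^ d

section treeRecursion

variable {lam γ : ℝ} {d : ℕ}

theorem continuousOn_treeRecursion {a : ℝ} (ha : 0 < a) (hγ : 0 ≤ γ) :
    ContinuousOn (treeRecursion lam γ d) (Ici a) := by
  unfold treeRecursion
  refine continuousOn_const.mul (ContinuousOn.pow (ContinuousOn.div (by fun_prop) (by fun_prop)
    fun x hx => ?_) d)
  have : 0 < x := ha.trans_le hx
  positivity

theorem lt_treeRecursion (hlam : 0 < lam) (hγ : 0 ≤ γ) (hγ1 : γ < 1) (hd : d ≠ 0) {y : ℝ}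
    (hy : 0 < y) : lam < treeRecursion lam γ d y := by
  have h : 1 < (y + 1) / (y + γ) := by
    rw [one_lt_div (by positivity)]
    linarith
  exact lt_mul_of_one_lt_right hlam (one_lt_pow₀ h hd)

theorem strictAntiOn_treeRecursion (hlam : 0 < lam) (hγ : 0 ≤ γ) (hγ1 : γ < 1) (hd : d ≠ 0) :
    StrictAntiOn (treeRecursion lam γ d) (Ioi 0) := by
  intro x hx y hy hxy
  have hx : 0 < x := hx
  have hy : 0 < y := hy
  refine mul_lt_mul_of_pos_left (pow_lt_pow_left₀ ?_ (by positivity) hd) hlam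
  rw [div_lt_div_iff₀ (by positivity) (by positivity)]
  nlinarith

theorem hasDerivAt_treeRecursion (hγ : 0 ≤ γ) (hd : d ≠ 0) {y : ℝ} (hy : 0 < y) :
    HasDerivAt (treeRecursion lam γ d)
      (-(treeRecursion lam γ d y * (d * (1 - γ)) / ((y + 1) * (y + γ)))) y := by
  have hγy : y + γ ≠ 0 := by positivity
  have h := ((((hasDerivAt_id y).add_const 1).div ((hasDerivAt_id y).add_const γ) hγy).pow
    d).const_mul lam
  refine h.congr_deriv ?_
  obtain ⟨n, rfl⟩ := Nat.exists_eq_succ_of_ne_zero hd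
  simp only [treeRecursion, Pi.div_apply, id, Nat.succ_eq_add_one, Nat.add_sub_cancel, pow_succ]
  field_simp
  ring

theorem treeRecursion_le_exp (hlam : 0 < lam) (hγ : 0 ≤ γ) (hγ1 : γ ≤ 1) {y : ℝ}
    (hy : 0 < y) : treeRecursion lam γ d y ≤ lam * Real.exp (d * (1 - γ) / y) := by
  refine mul_le_mul_of_nonneg_left ?_ hlam.le
  have h : (y + 1) / (y + γ) ≤ Real.exp ((1 - γ) / y) := by
    refine le_trans ?_ (Real.add_one_le_exp _)
    rw [div_add_one hy.ne', div_le_div_iff₀ (by positivity) hy]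
    nlinarith [mul_nonneg (sub_nonneg.2 hγ1) hγ]
  calc ((y + 1) / (y + γ)) ^ d ≤ Real.exp ((1 - γ) / y) ^ d := by gcongr
    _ = Real.exp (d * (1 - γ) / y) := by rw [← Real.exp_nat_mul, mul_div_assoc]

end treeRecursion

theorem exp_four_thirds_lt_four : Real.exp (4 / 3) < 4 := by
  have h : Real.exp (4 / 3) ^ 3 < 4 ^ 3 := by
    have h1 : Real.exp (4 / 3) ^ 3 = Real.exp 1 ^ 4 := by
      rw [← Real.exp_nat_mul, ← Real.exp_nat_mul]
      norm_num
    rw [h1]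
    calc Real.exp 1 ^ 4 < 2.7182818286 ^ 4 := by
          gcongr
          exact Real.exp_one_lt_d9
      _ < 4 ^ 3 := by norm_num
  exact lt_of_pow_lt_pow_left₀ 3 (by norm_num) h

/-- Non-uniqueness for `λ = L - 1` whenever `d (1 - γ) = 5 L` and `L ≥ 2`. -/
theorem exists_two_cycle_treeRecursion {L γ : ℝ} {d : ℕ} (hL : 2 ≤ L) (hγ : 0 ≤ γ) (hγ1 : γ < 1)
    (hd : d * (1 - γ) = 5 * L) :
    ∃ x y : ℝ, 0 < x ∧ 0 < y ∧ x ≠ y ∧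
      x = treeRecursion (L - 1) γ d y ∧ y = treeRecursion (L - 1) γ d x := by
  have hlam : 0 < L - 1 := by linarith
  have hd0 : d ≠ 0 := by
    rintro rfl
    norm_num at hd
    linarith
  set f := treeRecursion (L - 1) γ d
  set M := 17 / 4 * L - 1 with hM
  have hM0 : 0 < M := by linarith
  have hcont : ContinuousOn f (Ici (L - 1)) := continuousOn_treeRecursion hlam hγ
  have hmaps : ∀ x, L - 1 ≤ x → L - 1 < f x := fun x hx =>
    lt_treeRecursion hlam hγ hγ1 hd0 (hlam.trans_le hx)
  have hfM : f M ≤ M := by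
    have hexp : Real.exp (d * (1 - γ) / M) ≤ 4 := by
      refine (Real.exp_le_exp.2 ?_).trans exp_four_thirds_lt_four.le
      rw [hd, div_le_div_iff₀ hM0 (by norm_num)]
      linarith
    have := treeRecursion_le_exp (d := d) hlam hγ hγ1.le hM0
    nlinarith
  obtain ⟨p, hpI, hp0⟩ := intermediate_value_Icc' (show L - 1 ≤ M by linarith)
    ((hcont.mono Icc_subset_Ici_self).sub continuousOn_id)
    (show (0 : ℝ) ∈ Icc _ _ from
      ⟨sub_nonpos.2 hfM, (sub_pos.2 (hmaps _ le_rfl)).le⟩)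
  have hp : f p = p := sub_eq_zero.1 hp0
  have hap : L - 1 < p := hp ▸ hmaps p hpI.1
  have hppos : 0 < p := hlam.trans hap
  have hslope : -(f p * (d * (1 - γ)) / ((p + 1) * (p + γ))) < -1 := by
    rw [neg_lt_neg_iff, hp, hd, one_lt_div (by positivity)]
    have h1 : 0 ≤ (p - (L - 1)) * (M - p) :=
      mul_nonneg (sub_nonneg.2 hpI.1) (sub_nonneg.2 hpI.2)
    have h2 : (p + 1) * (p + γ) < (p + 1) * (p + 1) := by gcongr
    nlinarith
  obtain ⟨x, hax, hxp, hpfx, hx⟩ := exists_two_cycle_of_deriv_lt_neg_one hcont hmaps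
    ((strictAntiOn_treeRecursion hlam hγ hγ1 hd0).mono fun x hx => hlam.trans_le hx) hap hp
    (hasDerivAt_treeRecursion hγ hd0 hppos) hslope
  exact ⟨x, f x, hlam.trans hax, hppos.trans hpfx, (hxp.trans hpfx).ne, hx.symm, rfl⟩


/-- Non-uniqueness for the anti-ferromagnetic 2-spin system with `β = 1`,
`γ = 1 - 2^(-(k-2b))`, `λ = 2^b - 1` on the infinite `d`-ary tree, `d = 5·2^(k-b)`:
the tree-recursion system `x = λ((y+1)/(y+γ))^d`, `y = λ((x+1)/(x+γ))^d`
admits a solution with `x ≠ y`. -/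
theorem non_uniqueness (k b : ℕ) (hk : 2 ≤ k) (hb : 1 ≤ b) (hbk : 2 * b ≤ k) :
    ∃ x y : ℝ, 0 < x ∧ 0 < y ∧ x ≠ y ∧
      x = ((2 : ℝ) ^ b - 1) *
        ((y + 1) / (y + (1 - 1 / (2 : ℝ) ^ (k - 2 * b)))) ^ (5 * 2 ^ (k - b)) ∧
      y = ((2 : ℝ) ^ b - 1) *
        ((x + 1) / (x + (1 - 1 / (2 : ℝ) ^ (k - 2 * b)))) ^ (5 * 2 ^ (k - b)) := by
  have hε : (1 : ℝ) ≤ 2 ^ (k - 2 * b) := one_le_pow₀ (by norm_num)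
  refine exists_two_cycle_treeRecursion (le_self_pow₀ (by norm_num) (by omega)) ?_ ?_ ?_
  · exact sub_nonneg.2 (div_le_one_of_le₀ hε (by positivity))
  · exact sub_lt_self 1 (by positivity)
  · have hkb : k - b = (k - 2 * b) + b := by omega
    rw [hkb]
    push_cast
    rw [pow_add]
    field_simp
    ring
end

section
/- For all integers k ≥ 2 and b with 1 ≤ b ≤ k/2, there exists a real number z > z* with f(z) = 0, where z* = 5·2^b. -/
/-- The lower bound `log (1 + 1 / x) ≥ 1 / (x + 1)` in exponential form. -/
lemma exp_div_add_one_le_one_add_inv_pow {x : ℝ} (hx : 0 < x) (d : ℕ) :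
    Real.exp (d / (x + 1)) ≤ (1 + 1 / x) ^ d := by
  have h := Real.one_sub_inv_le_log_of_pos (show 0 < 1 + 1 / x by positivity)
  have hlog : 1 / (x + 1) ≤ Real.log (1 + 1 / x) := by
    refine le_trans (le_of_eq ?_) h
    field_simp
    ring
  rw [← Real.le_log_iff_exp_le (by positivity), Real.log_pow, div_eq_mul_one_div]
  gcongr

lemma one_add_inv_pow_le_exp_one {d : ℕ} (hd : 0 < d) {y : ℝ} (hy : (d : ℝ) ≤ y) :
    (1 + 1 / y) ^ d ≤ Real.exp 1 := by
  have hd' : (0 : ℝ) < d := by exact_mod_cast hd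
  calc (1 + 1 / y) ^ d ≤ (Real.exp (1 / (d : ℝ))) ^ d := by
        have : 0 < y := hd'.trans_le hy
        refine pow_le_pow_left₀ (by positivity) ?_ d
        have h1 := Real.add_one_le_exp (1 / (d : ℝ))
        have h2 : 1 / y ≤ 1 / (d : ℝ) := by gcongr
        linarith
    _ = Real.exp 1 := by
        rw [← Real.exp_nat_mul]
        congr 1
        field_simp

lemma five_mul_add_one_lt_mul_exp {a X : ℝ} (ha : 1 ≤ a) (hX : 0 < X) (hXe : X ≤ Real.exp 1) :
    5 * (a + 1) < a * Real.exp (5 * (a + 1) / (a * X + 1)) := by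
  have he := Real.exp_one_lt_d9
  have he' := Real.exp_one_gt_d9
  have hX' : X ≤ 2.7183 := by linarith
  set t := 5 * (a + 1) / (a * 2.7183 + 1) with ht
  have hle : t ≤ 5 * (a + 1) / (a * X + 1) := by
    rw [ht]
    gcongr
  have htangent : 7.38 * (t - 1) ≤ Real.exp t := by
    have h2 : (7.38 : ℝ) ≤ Real.exp 2 := by
      rw [show (2 : ℝ) = 1 + 1 by norm_num, Real.exp_add]
      nlinarith
    have ht1 : 0 ≤ t - 1 := by
      rw [ht, sub_nonneg, le_div_iff₀ (by positivity)]
      linarith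
    calc 7.38 * (t - 1) ≤ Real.exp 2 * Real.exp (t - 2) := by
          gcongr
          linarith [Real.add_one_le_exp (t - 2)]
      _ = Real.exp t := by rw [← Real.exp_add]; congr 1; ring
  have hpoly : 5 * (a + 1) < a * (7.38 * (t - 1)) := by
    have : a * (7.38 * (t - 1)) =
        a * (7.38 * (5 * (a + 1) - (a * 2.7183 + 1))) / (a * 2.7183 + 1) := by
      rw [ht]
      field_simp
    rw [this, lt_div_iff₀ (by positivity)]
    nlinarith
  calc 5 * (a + 1) < a * (7.38 * (t - 1)) := hpoly
    _ ≤ a * Real.exp (5 * (a + 1) / (a * X + 1)) := by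
        gcongr
        exact htangent.trans (Real.exp_le_exp.mpr hle)

/-- The two-step recursion with real parameters `a, m ≥ 1` has a fixed point beyond
`5 * (a + 1)`. -/
lemma exists_zero_gt_of_one_le {a m : ℝ} (ha : 1 ≤ a) (hm : 1 ≤ m) {d : ℕ}
    (hd : (d : ℝ) = 5 * m * (a + 1)) :
    ∃ z : ℝ, 5 * (a + 1) < z ∧
      a * (1 + 1 / (m * a * (1 + 1 / (m * z + m - 1)) ^ d + m - 1)) ^ d - z = 0 := by
  have hd0 : 0 < d := by
    have : (0 : ℝ) < d := by rw [hd]; positivity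
    exact_mod_cast this
  set f : ℝ → ℝ := fun z ↦
    a * (1 + 1 / (m * a * (1 + 1 / (m * z + m - 1)) ^ d + m - 1)) ^ d - z with hf
  have hinner : ∀ z, 5 * (a + 1) ≤ z → 0 < m * z + m - 1 := fun z hz ↦ by
    have hz0 : 0 < z := by linarith
    have : 0 < m * z := by positivity
    linarith
  have hone : ∀ z, 5 * (a + 1) ≤ z → 1 ≤ (1 + 1 / (m * z + m - 1)) ^ d := fun z hz ↦ by
    have := hinner z hz
    exact one_le_pow₀ (le_add_of_nonneg_right (by positivity))
  have hma : 0 < m * a + m - 1 := by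
    have : 0 < m * a := by positivity
    linarith
  have houter : ∀ z, 5 * (a + 1) ≤ z →
      m * a + m - 1 ≤ m * a * (1 + 1 / (m * z + m - 1)) ^ d + m - 1 := fun z hz ↦ by
    have : m * a ≤ m * a * (1 + 1 / (m * z + m - 1)) ^ d :=
      le_mul_of_one_le_right (by positivity) (hone z hz)
    linarith
  have hpos : 0 < f (5 * (a + 1)) := by
    set X := (1 + 1 / (m * (5 * (a + 1)) + m - 1)) ^ d with hX
    have hX1 : 1 ≤ X := hone _ le_rfl
    have hXe : X ≤ Real.exp 1 := one_add_inv_pow_le_exp_one hd0 (by rw [hd]; linarith)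
    have hn : 0 < m * a * X + m - 1 := hma.trans_le (houter _ le_rfl)
    have hY := exp_div_add_one_le_one_add_inv_pow hn d
    have hexp : (d : ℝ) / (m * a * X + m - 1 + 1) = 5 * (a + 1) / (a * X + 1) := by
      rw [hd, show m * a * X + m - 1 + 1 = m * (a * X + 1) by ring]
      field_simp
    rw [hexp] at hY
    have hlt := five_mul_add_one_lt_mul_exp ha (by linarith) hXe
    exact sub_pos.mpr (hlt.trans_le (by gcongr))
  set C := a * (1 + 1 / (m * a + m - 1)) ^ d with hC
  have hCpos : 0 < C := by positivity
  have hZ : 5 * (a + 1) ≤ 5 * (a + 1) + C := by linarith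
  have hneg : f (5 * (a + 1) + C) < 0 := by
    have h1 := houter _ hZ
    have h2 : 0 < m * a * (1 + 1 / (m * (5 * (a + 1) + C) + m - 1)) ^ d + m - 1 :=
      hma.trans_le h1
    have : a * (1 + 1 / (m * a * (1 + 1 / (m * (5 * (a + 1) + C) + m - 1)) ^ d + m - 1)) ^ d
        ≤ C := by
      rw [hC]
      gcongr
    simp only [hf]
    linarith
  have hcont : ContinuousOn f (Set.Icc (5 * (a + 1)) (5 * (a + 1) + C)) := by
    have hin : ∀ z ∈ Set.Icc (5 * (a + 1)) (5 * (a + 1) + C), m * z + m - 1 ≠ 0 :=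
      fun z hz ↦ (hinner z hz.1).ne'
    have hout : ∀ z ∈ Set.Icc (5 * (a + 1)) (5 * (a + 1) + C),
        m * a * (1 + 1 / (m * z + m - 1)) ^ d + m - 1 ≠ 0 :=
      fun z hz ↦ (hma.trans_le (houter z hz.1)).ne'
    simp only [hf]
    fun_prop (disch := assumption)
  obtain ⟨z, hz, hz0⟩ := intermediate_value_Ioo' hZ hcont ⟨hneg, hpos⟩
  exact ⟨z, hz.1, hz0⟩

/-- For integers `k ≥ 2`, `1 ≤ b ≤ k/2`, with `d = 5·2^(k-b)` and `z* = 5·2^b`,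
the function `f` has a zero on `(z*, ∞)`. -/
theorem f_has_zero_beyond_zstar (k b : ℕ) (hk : 2 ≤ k) (hb : 1 ≤ b) (hbk : 2 * b ≤ k) :
    ∃ z : ℝ, 5 * 2 ^ b < z ∧
      ((2 : ℝ) ^ b - 1) *
          (1 + 1 / ((2 : ℝ) ^ (k - 2 * b) * ((2 : ℝ) ^ b - 1) *
              (1 + 1 / ((2 : ℝ) ^ (k - 2 * b) * z + (2 : ℝ) ^ (k - 2 * b) - 1))
                ^ (5 * 2 ^ (k - b)) + (2 : ℝ) ^ (k - 2 * b) - 1))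
            ^ (5 * 2 ^ (k - b)) - z = 0 := by
  have ha : (1 : ℝ) ≤ 2 ^ b - 1 := by
    have : (2 : ℝ) ^ 1 ≤ 2 ^ b := pow_le_pow_right₀ one_le_two hb
    linarith
  have hm : (1 : ℝ) ≤ 2 ^ (k - 2 * b) := one_le_pow₀ one_le_two
  have hd : ((5 * 2 ^ (k - b) : ℕ) : ℝ) = 5 * 2 ^ (k - 2 * b) * ((2 : ℝ) ^ b - 1 + 1) := by
    rw [show k - b = (k - 2 * b) + b by omega]
    push_cast
    ring
  simpa only [sub_add_cancel] using exists_zero_gt_of_one_le ha hm hd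
end
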